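/- Let w ∈ H_{2,n}(q) be a product of k ≥ 1 loopings, say w = t₁t₂⋯t_k where each t_j is a looping of index i_j, and set m = min_j i_j and M = max_j i_j. Then w is a finite ℤ[q,q⁻¹]-linear combination of elements of the form w′G, where w′ is a product of k loopings whose indices all lie in the interval [m,M] and are non-decreasing from left to right, and G is a finite product of elements gᵢ^{±1} with i ∈ [m, M−1] (with G = 1 when m = M). (Theorem 2, Part A.) -/

import Mathlib

noncomputable section

namespace MixedHecke

/-- The ring `ℤ[q,q⁻¹]` of Laurent polynomials over `ℤ`. -/
abbrev R : Type := LaurentPolynomial ℤ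

/-- The variable `q`. -/
def q : R := LaurentPolynomial.T 1

/-- The inverse `q⁻¹` of the variable `q`. -/
def qinv : R := LaurentPolynomial.T (-1)

/-- Generators of the mixed braid group `B_{2,n}`:
`Sum.inl true` is `𝒯`, `Sum.inl false` is `τ`, and `Sum.inr ⟨i, _⟩` is `σ_i` for `1 ≤ i ≤ n-1`. -/
def Gen (n : ℕ) : Type := Bool ⊕ {i : ℕ // 1 ≤ i ∧ i < n}

/-- The generator `𝒯` in the free group. -/
def fT (n : ℕ) : FreeGroup (Gen n) := FreeGroup.of (Sum.inl true)

/-- The generator `τ` in the free group. -/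
def ftau (n : ℕ) : FreeGroup (Gen n) := FreeGroup.of (Sum.inl false)

/-- The generator `σ_i` in the free group (junk value `1` for `i` out of range). -/
def fs (n i : ℕ) : FreeGroup (Gen n) :=
  if h : 1 ≤ i ∧ i < n then FreeGroup.of (Sum.inr ⟨i, h⟩) else 1

/-- The defining relators of the mixed braid group `B_{2,n}`. -/
def rels (n : ℕ) : Set (FreeGroup (Gen n)) :=
  { x | (∃ k j, 1 ≤ j ∧ j + 1 < k ∧ k < n ∧
          x = fs n k * fs n j * (fs n j * fs n k)⁻¹) ∨
        (∃ k, 1 ≤ k ∧ k + 1 < n ∧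
          x = fs n k * fs n (k+1) * fs n k * (fs n (k+1) * fs n k * fs n (k+1))⁻¹) ∨
        (∃ k, 2 ≤ k ∧ k < n ∧ x = fT n * fs n k * (fs n k * fT n)⁻¹) ∨
        (∃ k, 2 ≤ k ∧ k < n ∧ x = ftau n * fs n k * (fs n k * ftau n)⁻¹) ∨
        (1 < n ∧ x = fT n * fs n 1 * fT n * fs n 1 * (fs n 1 * fT n * fs n 1 * fT n)⁻¹) ∨
        (1 < n ∧ x = ftau n * fs n 1 * ftau n * fs n 1 * (fs n 1 * ftau n * fs n 1 * ftau n)⁻¹) ∨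
        (1 < n ∧ x = ftau n * (fs n 1 * fT n * fs n 1) * ((fs n 1 * fT n * fs n 1) * ftau n)⁻¹) }

/-- The mixed braid group `B_{2,n}` on two fixed strands. -/
abbrev B (n : ℕ) : Type := PresentedGroup (rels n)

/-- The group algebra `ℤ[q,q⁻¹] B_{2,n}`. -/
abbrev GA (n : ℕ) : Type := MonoidAlgebra R (B n)

/-- The image of `σ_i` in the group algebra. -/
def gA (n i : ℕ) : GA n := MonoidAlgebra.of R (B n) (PresentedGroup.mk (rels n) (fs n i))

/-- The quadratic relations `σ_i² = (q-1)σ_i + q·1`, `i = 1, …, n-1`. -/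
inductive quadRel (n : ℕ) : GA n → GA n → Prop
  | intro (i : ℕ) (h1 : 1 ≤ i) (h2 : i < n) :
      quadRel n (gA n i * gA n i) ((q - 1) • gA n i + q • (1 : GA n))

/-- The mixed Hecke algebra `H_{2,n}(q)`: the quotient of the group algebra `ℤ[q,q⁻¹] B_{2,n}`
by the two-sided ideal generated by the quadratic relations. -/
abbrev H (n : ℕ) : Type := RingQuot (quadRel n)

/-- The canonical monoid homomorphism `B_{2,n} →* H_{2,n}(q)`. -/
def π (n : ℕ) : B n →* H n :=
  (RingQuot.mkAlgHom R (quadRel n)).toMonoidHom.comp (MonoidAlgebra.of R (B n))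

/-- The canonical map from the free group on the generators to the units of `H_{2,n}(q)`
(images of group elements are units). -/
def U (n : ℕ) : FreeGroup (Gen n) →* (H n)ˣ :=
  ((π n).comp (PresentedGroup.mk (rels n))).toHomUnits

/-- The braiding generator `g_i` as a unit of `H_{2,n}(q)`. -/
def g (n i : ℕ) : (H n)ˣ := U n (fs n i)

/-- The word for the looping element `𝒯_i` : `𝒯_1 = 𝒯` and `𝒯_{i+1} = σ_i 𝒯_i σ_i`,
i.e. `𝒯_i = σ_{i-1} ⋯ σ_1 𝒯 σ_1 ⋯ σ_{i-1}`. -/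
def wT (n : ℕ) : ℕ → FreeGroup (Gen n)
  | 0 => 1
  | 1 => fT n
  | (i+2) => fs n (i+1) * wT n (i+1) * fs n (i+1)

/-- The word for the looping element `τ_i` : `τ_1 = τ` and `τ_{i+1} = σ_i τ_i σ_i`,
i.e. `τ_i = σ_{i-1} ⋯ σ_1 τ σ_1 ⋯ σ_{i-1}`. -/
def wtau (n : ℕ) : ℕ → FreeGroup (Gen n)
  | 0 => 1
  | 1 => ftau n
  | (i+2) => fs n (i+1) * wtau n (i+1) * fs n (i+1)

/-- The looping element `𝒯_i` as a unit of `H_{2,n}(q)`. -/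
def T (n i : ℕ) : (H n)ˣ := U n (wT n i)

/-- The looping element `τ_i` as a unit of `H_{2,n}(q)`. -/
def tau (n i : ℕ) : (H n)ˣ := U n (wtau n i)

/-- The loopings of index `i` : `𝒯_i, τ_i, 𝒯_i⁻¹, τ_i⁻¹`, as units of `H_{2,n}(q)`. -/
def LoopU (n i : ℕ) : Set (H n)ˣ := {T n i, tau n i, (T n i)⁻¹, (tau n i)⁻¹}

/-- The braiding generators `g_i`, `1 ≤ i ≤ n-1`, as elements of `H_{2,n}(q)`. -/
def BraidGens (n : ℕ) : Set (H n) := {x | ∃ i, 1 ≤ i ∧ i < n ∧ x = (g n i : H n)}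

/-- The elements `g_i^{±1}` with `lo ≤ i ≤ hi - 1`, as elements of `H_{2,n}(q)`. -/
def BraidPM (n lo hi : ℕ) : Set (H n) :=
  {x | ∃ i, lo ≤ i ∧ i < hi ∧ (x = (g n i : H n) ∨ x = ((g n i)⁻¹ : (H n)ˣ))}


section Swap

variable {K E : Type*} [CommSemiring K] [Semiring E] [Algebra K E]

/-- `s` and `s⁻¹` differ by scalars, up to a scalar multiple. -/
def IsQuadratic (K : Type*) {E : Type*} [CommSemiring K] [Semiring E] [Algebra K E] (s : Eˣ) : Prop :=
  (∃ c d : K, (s : E) = c • ((s⁻¹ : Eˣ) : E) + d • 1) ∧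
    ∃ c d : K, ((s⁻¹ : Eˣ) : E) = c • (s : E) + d • 1

theorem IsQuadratic.of_sq {K E : Type*} [CommRing K] [Semiring E] [Algebra K E] {s : Eˣ}
    {c d d' : K} (hd : d' * d = 1) (h : (s : E) * s = c • (s : E) + d • 1) :
    IsQuadratic K s := by
  have e : (s : E) = c • (1 : E) + d • ((s⁻¹ : Eˣ) : E) := by
    have := congrArg (fun z => z * ((s⁻¹ : Eˣ) : E)) h
    simpa only [mul_assoc, add_mul, smul_mul_assoc, Units.mul_inv, mul_one, one_mul] using this
  refine ⟨⟨d, c, by rw [add_comm]; exact e⟩, d', -(d' * c), ?_⟩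
  have h' := congrArg (fun z => d' • z) e
  simp only [smul_add, smul_smul, hd, one_smul] at h'
  rw [h', add_right_comm, ← add_smul, add_neg_cancel, zero_smul, zero_add]

theorem IsQuadratic.inv {s : Eˣ} (h : IsQuadratic K s) : IsQuadratic K s⁻¹ :=
  ⟨by simpa using h.2, by simpa using h.1⟩

theorem IsQuadratic.swap {s : Eˣ} (h : IsQuadratic K s) {N : Submodule K E} (a b : E)
    (h₁ : a * ((s⁻¹ : Eˣ) : E) * b ∈ N) (h₂ : a * b ∈ N) : a * (s : E) * b ∈ N := by
  obtain ⟨c, d, e⟩ := h.1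
  rw [e]
  simp only [mul_add, add_mul, mul_smul_comm, smul_mul_assoc, mul_one]
  exact N.add_mem (N.smul_mem _ h₁) (N.smul_mem _ h₂)

theorem IsQuadratic.swap_units {s : Eˣ} (h : IsQuadratic K s) {N : Submodule K E} (a b : Eˣ)
    (h₁ : ((a * s⁻¹ * b : Eˣ) : E) ∈ N) (h₂ : ((a * b : Eˣ) : E) ∈ N) :
    ((a * s * b : Eˣ) : E) ∈ N := by
  push_cast at *
  exact h.swap _ _ h₁ h₂

variable {s x y : Eˣ} (hs : IsQuadratic K s) {N : Submodule K E}
include hs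

theorem swap_same_sign (h : Commute x (s * y * s))
    (h₁ : ((y * (s * x * s) * (s⁻¹ * s⁻¹) : Eˣ) : E) ∈ N)
    (h₂ : ((x * (s * y * s) * s⁻¹ : Eˣ) : E) ∈ N) :
    (((s * x * s) * y : Eˣ) : E) ∈ N := by
  have e : (s * x * s) * y = s * s * (y * s * x * s⁻¹) := by
    calc (s * x * s) * y = s * (x * (s * y * s)) * s⁻¹ := by group
      _ = s * ((s * y * s) * x) * s⁻¹ := by rw [h.eq]
      _ = _ := by group
  rw [e]
  apply hs.swap_units
  · convert h₁ using 2; group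
  · convert h₂ using 2
    rw [h.eq]; group

theorem swap_opposite_sign (h : Commute x (s * y * s))
    (h₁ : ((y⁻¹ * (s * x * s) : Eˣ) : E) ∈ N)
    (h₂ : ((y⁻¹ * x * s : Eˣ) : E) ∈ N)
    (h₃ : (((s * x * s) * (s * y * s)⁻¹ * s : Eˣ) : E) ∈ N) :
    (((s * x * s) * y⁻¹ : Eˣ) : E) ∈ N := by
  apply hs.swap_units
  · have e : s * x * s⁻¹ * y⁻¹ = y⁻¹ * s⁻¹ * (x * s) := by
      calc s * x * s⁻¹ * y⁻¹ = s * (x * (s * y * s)⁻¹) * s := by group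
        _ = s * ((s * y * s)⁻¹ * x) * s := by rw [h.inv_right.eq]
        _ = _ := by group
    rw [e]
    apply hs.inv.swap_units
    · convert h₁ using 2; group
    · convert h₂ using 2; group
  · convert h₃ using 2; group

theorem swap_triple (h : Commute x (s * y * s)) (h' : Commute y (s * y * s))
    (h₁ : ((y⁻¹ * (s * x * s) * (s * y * s)⁻¹ * (s * s) : Eˣ) : E) ∈ N)
    (h₂ : ((y⁻¹ * x * y⁻¹ * s : Eˣ) : E) ∈ N) :
    (((s * x * s) * (s * y * s)⁻¹ * y⁻¹ : Eˣ) : E) ∈ N := by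
  have e : (s * x * s) * (s * y * s)⁻¹ * y⁻¹ = y⁻¹ * s⁻¹ * (x * y⁻¹ * s) := by
    calc (s * x * s) * (s * y * s)⁻¹ * y⁻¹ = s * x * s * ((s * y * s)⁻¹ * y⁻¹) := by group
      _ = s * x * s * (y⁻¹ * (s * y * s)⁻¹) := by rw [h'.inv_inv.eq]
      _ = s * x * s * (y⁻¹ * (s * y * s)⁻¹) * s⁻¹ * s := by group
      _ = s * x * (s * (y⁻¹ * (s * y * s)⁻¹) * s⁻¹) * s := by group
      _ = s * x * (s * ((s * y * s)⁻¹ * y⁻¹) * s⁻¹) * s := by rw [h'.inv_inv.eq]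
      _ = s * x * (y⁻¹ * (s * y * s)⁻¹) * s := by group
      _ = s * x * ((s * y * s)⁻¹ * y⁻¹) * s := by rw [h'.inv_inv.eq]
      _ = s * (x * (s * y * s)⁻¹) * y⁻¹ * s := by group
      _ = s * ((s * y * s)⁻¹ * x) * y⁻¹ * s := by rw [h.inv_right.eq]
      _ = _ := by group
  rw [e]
  apply hs.inv.swap_units
  · convert h₁ using 2; group
  · convert h₂ using 2; group

end Swap

section Relations

variable {n : ℕ}

theorem U_eq_of_mem_rels {x y : FreeGroup (Gen n)} (h : x * y⁻¹ ∈ rels n) : U n x = U n y := by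
  ext
  exact congrArg (π n) (PresentedGroup.mk_eq_mk_of_mul_inv_mem h)

theorem commute_g_of_lt {k j : ℕ} (h₁ : 1 ≤ j) (h₂ : j + 1 < k) (h₃ : k < n) :
    Commute (g n k) (g n j) := by
  have := U_eq_of_mem_rels (n := n) (x := fs n k * fs n j) (y := fs n j * fs n k)
    (Or.inl ⟨k, j, h₁, h₂, h₃, rfl⟩)
  rwa [map_mul, map_mul] at this

theorem g_braid {k : ℕ} (h₁ : 1 ≤ k) (h₂ : k + 1 < n) :
    g n k * g n (k + 1) * g n k = g n (k + 1) * g n k * g n (k + 1) := by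
  have := U_eq_of_mem_rels (n := n) (x := fs n k * fs n (k + 1) * fs n k)
    (y := fs n (k + 1) * fs n k * fs n (k + 1)) (Or.inr (Or.inl ⟨k, h₁, h₂, rfl⟩))
  rwa [map_mul, map_mul, map_mul, map_mul] at this

theorem isQuadratic_g {i : ℕ} (h₁ : 1 ≤ i) (h₂ : i < n) : IsQuadratic R (g n i) := by
  have hq : qinv * q = 1 := by
    rw [q, qinv, ← LaurentPolynomial.T_add, neg_add_cancel, LaurentPolynomial.T_zero]
  refine IsQuadratic.of_sq (c := q - 1) hq ?_
  have h := RingQuot.mkAlgHom_rel R (quadRel.intro i h₁ h₂)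
  rw [map_mul, map_add, map_smul, map_smul, map_one] at h
  exact h

/-- The looping element `𝒯_i` for `b = true` and `τ_i` for `b = false`. -/
def looping (n : ℕ) (b : Bool) (i : ℕ) : (H n)ˣ := bif b then T n i else tau n i

theorem looping_succ (b : Bool) {i : ℕ} (h : 1 ≤ i) :
    looping n b (i + 1) = g n i * looping n b i * g n i := by
  obtain ⟨i, rfl⟩ := Nat.exists_eq_add_of_le' h
  cases b <;> simp [looping, T, tau, wT, wtau, g]

theorem commute_looping_one_g (b : Bool) {k : ℕ} (h₁ : 2 ≤ k) (h₂ : k < n) :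
    Commute (looping n b 1) (g n k) := by
  cases b
  · have := U_eq_of_mem_rels (n := n) (x := ftau n * fs n k) (y := fs n k * ftau n)
      (Or.inr (Or.inr (Or.inr (Or.inl ⟨k, h₁, h₂, rfl⟩))))
    rwa [map_mul, map_mul] at this
  · have := U_eq_of_mem_rels (n := n) (x := fT n * fs n k) (y := fs n k * fT n)
      (Or.inr (Or.inr (Or.inl ⟨k, h₁, h₂, rfl⟩)))
    rwa [map_mul, map_mul] at this

theorem commute_looping_g (b : Bool) {i j : ℕ} (h : 1 ≤ i) (h₁ : i < j) (h₂ : j < n) :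
    Commute (looping n b i) (g n j) := by
  induction i, h using Nat.le_induction with
  | base => exact commute_looping_one_g b h₁ h₂
  | succ i h ih =>
    rw [looping_succ b h]
    have := (commute_g_of_lt h h₁ h₂).symm
    exact (this.mul_left (ih (by omega))).mul_left this

theorem commute_g_looping (b : Bool) {i j : ℕ} (h : 1 ≤ i) (h₁ : i + 2 ≤ j) (h₂ : j ≤ n) :
    Commute (g n i) (looping n b j) := by
  induction j, h₁ using Nat.le_induction with
  | base =>
    rw [looping_succ b (by omega), looping_succ b h]
    have hb := g_braid h (by omega : i + 1 < n)
    have hc := commute_looping_g b h (Nat.lt_succ_self i) (by omega : i + 1 < n)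
    set a := g n i
    set c := g n (i + 1)
    set X := looping n b i
    calc a * (c * (a * X * a) * c) = (a * c * a) * X * a * c := by group
      _ = c * a * (c * X) * a * c := by rw [hb]; group
      _ = c * a * X * (c * a * c) := by rw [← hc.eq]; group
      _ = c * (a * X * a) * c * a := by rw [← hb]; group
  | succ j h₁ ih =>
    rw [looping_succ b (by omega)]
    have := (commute_g_of_lt h h₁ h₂).symm
    exact (this.mul_right (ih (by omega))).mul_right this

theorem commute_looping_looping_succ (b c : Bool) (hbc : b = false ∨ c = true) {i : ℕ}
    (h : 1 ≤ i) (h₁ : i < n) :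
    Commute (looping n b i) (g n i * looping n c i * g n i) := by
  induction i, h using Nat.le_induction with
  | base =>
    rcases b with _ | _ <;> rcases c with _ | _
    · have := U_eq_of_mem_rels (n := n) (x := ftau n * fs n 1 * ftau n * fs n 1)
        (y := fs n 1 * ftau n * fs n 1 * ftau n)
        (Or.inr (Or.inr (Or.inr (Or.inr (Or.inr (Or.inl ⟨h₁, rfl⟩))))))
      simp only [map_mul, mul_assoc] at this
      refine Eq.trans ?_ (this.trans ?_) <;> simp only [mul_assoc] <;> rfl
    · have := U_eq_of_mem_rels (n := n) (x := ftau n * (fs n 1 * fT n * fs n 1))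
        (y := (fs n 1 * fT n * fs n 1) * ftau n)
        (Or.inr (Or.inr (Or.inr (Or.inr (Or.inr (Or.inr ⟨h₁, rfl⟩))))))
      simp only [map_mul] at this
      exact this
    · simp at hbc
    · have := U_eq_of_mem_rels (n := n) (x := fT n * fs n 1 * fT n * fs n 1)
        (y := fs n 1 * fT n * fs n 1 * fT n)
        (Or.inr (Or.inr (Or.inr (Or.inr (Or.inl ⟨h₁, rfl⟩)))))
      simp only [map_mul, mul_assoc] at this
      refine Eq.trans ?_ (this.trans ?_) <;> simp only [mul_assoc] <;> rfl
  | succ i h ih =>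
    have ih := ih (by omega)
    rw [looping_succ b h, looping_succ c h]
    have hb := g_braid h h₁
    have hX := commute_looping_g b h (Nat.lt_succ_self i) h₁
    have hY := commute_looping_g c h (Nat.lt_succ_self i) h₁
    set a := g n i
    set d := g n (i + 1)
    set X := looping n b i
    set Y := looping n c i
    symm
    calc d * (a * Y * a) * d * (a * X * a) = d * a * Y * (a * d * a) * X * a := by group
      _ = d * a * (Y * d) * a * (d * X) * a := by rw [hb]; group
      _ = d * a * (d * Y) * a * (X * d) * a := by rw [hY.eq, hX.eq]
      _ = (d * a * d) * Y * a * X * d * a := by group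
      _ = a * d * ((a * Y * a) * X) * d * a := by rw [← hb]; group
      _ = a * d * (X * (a * Y * a)) * d * a := by rw [ih.eq]
      _ = a * (d * X) * a * Y * (a * d * a) := by group
      _ = a * (X * d) * a * Y * (d * a * d) := by rw [hX.eq, hb]
      _ = a * X * d * a * (Y * d) * a * d := by group
      _ = a * X * (d * a * d) * Y * a * d := by rw [hY.eq]; group
      _ = (a * X * a) * (d * (a * Y * a) * d) := by rw [← hb]; group

end Relations

section Submodules

variable {n : ℕ}

/-- The span of the products of the elements `g_i^{±1}` with `m ≤ i < M`. -/
def braidSpan (n m M : ℕ) : Submodule R (H n) :=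
  Submodule.span R (Submonoid.closure (BraidPM n m M) : Set (H n))

/-- The span of the loopings of index `i`. -/
def loopSpan (n i : ℕ) : Submodule R (H n) :=
  Submodule.span R {x | ∃ t ∈ LoopU n i, x = (t : H n)}

/-- The span of the loopings with index in `[m, M]`. -/
def loopSpanIcc (n m M : ℕ) : Submodule R (H n) :=
  Submodule.span R {x | ∃ i, m ≤ i ∧ i ≤ M ∧ ∃ t ∈ LoopU n i, x = (t : H n)}

/-- The span of the products of `k` loopings with index in `[m, M]`, times braiding generators. -/
def wordSpan (n m M k : ℕ) : Submodule R (H n) :=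
  loopSpanIcc n m M ^ k * braidSpan n m M

theorem looping_mem_LoopU (b : Bool) (i : ℕ) : looping n b i ∈ LoopU n i := by
  cases b <;> simp [looping, LoopU]

theorem looping_inv_mem_LoopU (b : Bool) (i : ℕ) : (looping n b i)⁻¹ ∈ LoopU n i := by
  cases b <;> simp [looping, LoopU]

theorem exists_looping_of_mem_LoopU {i : ℕ} {t : (H n)ˣ} (h : t ∈ LoopU n i) :
    ∃ b, t = looping n b i ∨ t = (looping n b i)⁻¹ := by
  rcases h with h | h | h | h
  exacts [⟨true, Or.inl h⟩, ⟨false, Or.inl h⟩, ⟨true, Or.inr h⟩, ⟨false, Or.inr h⟩]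

theorem mem_loopSpan {i : ℕ} {t : (H n)ˣ} (h : t ∈ LoopU n i) : (t : H n) ∈ loopSpan n i :=
  Submodule.subset_span ⟨t, h, rfl⟩

theorem mem_loopSpanIcc {m M i : ℕ} (h₁ : m ≤ i) (h₂ : i ≤ M) {t : (H n)ˣ} (h : t ∈ LoopU n i) :
    (t : H n) ∈ loopSpanIcc n m M :=
  Submodule.subset_span ⟨i, h₁, h₂, t, h, rfl⟩

theorem loopSpanIcc_le_sup {m M : ℕ} :
    loopSpanIcc n m M ≤ loopSpan n m ⊔ loopSpanIcc n (m + 1) M := by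
  refine Submodule.span_le.2 ?_
  rintro _ ⟨i, h₁, h₂, t, ht, rfl⟩
  rcases h₁.eq_or_lt with rfl | h₁
  · exact Submodule.mem_sup_left (mem_loopSpan ht)
  · exact Submodule.mem_sup_right (mem_loopSpanIcc h₁ h₂ ht)

theorem braidSpan_mono {m m' M : ℕ} (h : m ≤ m') : braidSpan n m' M ≤ braidSpan n m M := by
  refine Submodule.span_mono (Submonoid.closure_mono ?_)
  rintro _ ⟨i, h₁, h₂, hx⟩
  exact ⟨i, h.trans h₁, h₂, hx⟩

theorem one_mem_braidSpan (m M : ℕ) : (1 : H n) ∈ braidSpan n m M :=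
  Submodule.subset_span (one_mem _)

theorem g_mem_braidSpan {m M i : ℕ} (h₁ : m ≤ i) (h₂ : i < M) :
    (g n i : H n) ∈ braidSpan n m M :=
  Submodule.subset_span (Submonoid.subset_closure ⟨i, h₁, h₂, Or.inl rfl⟩)

theorem g_inv_mem_braidSpan {m M i : ℕ} (h₁ : m ≤ i) (h₂ : i < M) :
    (((g n i)⁻¹ : (H n)ˣ) : H n) ∈ braidSpan n m M :=
  Submodule.subset_span (Submonoid.subset_closure ⟨i, h₁, h₂, Or.inr rfl⟩)

theorem braidSpan_mul_self (m M : ℕ) : braidSpan n m M * braidSpan n m M = braidSpan n m M := by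
  rw [braidSpan, ← Algebra.adjoin_eq_span, (Subalgebra.isIdempotentElem_toSubmodule _).eq]

theorem mul_mem_braidSpan {m M : ℕ} {x y : H n} (hx : x ∈ braidSpan n m M)
    (hy : y ∈ braidSpan n m M) : x * y ∈ braidSpan n m M := by
  rw [← braidSpan_mul_self]
  exact Submodule.mul_mem_mul hx hy

/-- A submodule stable under left multiplication by the `g_i`, `m ≤ i < M`, is stable under
left multiplication by `braidSpan n m M`. -/
theorem braidSpan_mul_le {m M : ℕ} (hm : 1 ≤ m) (hM : M ≤ n) {N : Submodule R (H n)}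
    (h : ∀ i, m ≤ i → i < M → ∀ z ∈ N, (g n i : H n) * z ∈ N) : braidSpan n m M * N ≤ N := by
  have key : ∀ x ∈ Submonoid.closure (BraidPM n m M), ∀ z ∈ N, x * z ∈ N := by
    intro x hx
    induction hx using Submonoid.closure_induction with
    | mem x hx =>
      obtain ⟨i, h₁, h₂, rfl | rfl⟩ := hx
      · exact h i h₁ h₂
      · intro z hz
        have := (isQuadratic_g (n := n) (hm.trans h₁) (h₂.trans_le hM)).inv.swap (N := N) 1 z
          (by simpa using h i h₁ h₂ z hz) (by simpa using hz)
        simpa using this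
    | one => simp
    | mul x y _ _ hx hy => intro z hz; rw [mul_assoc]; exact hx _ (hy _ hz)
  rw [Submodule.mul_le]
  intro x hx z hz
  induction hx using Submodule.span_induction with
  | mem x hx => exact key x hx z hz
  | zero => simp
  | add x y _ _ hx hy => rw [add_mul]; exact N.add_mem hx hy
  | smul c x _ hx => rw [smul_mul_assoc]; exact N.smul_mem c hx

theorem le_mul_braidSpan {m M : ℕ} (N : Submodule R (H n)) : N ≤ N * braidSpan n m M := by
  intro x hx
  simpa using Submodule.mul_mem_mul hx (one_mem_braidSpan m M)

theorem le_braidSpan_mul {m M : ℕ} (N : Submodule R (H n)) : N ≤ braidSpan n m M * N := by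
  intro x hx
  simpa using Submodule.mul_mem_mul (one_mem_braidSpan m M) hx

/-- A span of a set commutes past `braidSpan` as soon as this holds for generators. -/
theorem braidSpan_mul_span_le {m M : ℕ} (hm : 1 ≤ m) (hM : M ≤ n) {S : Set (H n)}
    (h : ∀ i, m ≤ i → i < M → ∀ z ∈ S,
      (g n i : H n) * z ∈ Submodule.span R S * braidSpan n m M) :
    braidSpan n m M * Submodule.span R S ≤ Submodule.span R S * braidSpan n m M := by
  refine le_trans (mul_le_mul_right (le_mul_braidSpan (m := m) (M := M) _) _)
    (braidSpan_mul_le hm hM ?_)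
  intro i h₁ h₂ z hz
  induction hz using Submodule.mul_induction_on' with
  | mem_mul_mem x hx y hy =>
    rw [← mul_assoc, ← braidSpan_mul_self, ← mul_assoc]
    refine Submodule.mul_mem_mul ?_ hy
    induction hx using Submodule.span_induction with
    | mem x hx => exact h i h₁ h₂ x hx
    | zero => simp
    | add x y _ _ hx hy => rw [mul_add]; exact Submodule.add_mem _ hx hy
    | smul c x _ hx => rw [mul_smul_comm]; exact Submodule.smul_mem _ c hx
  | add x _ y _ hx hy => rw [mul_add]; exact Submodule.add_mem _ hx hy

theorem braidSpan_succ_mul_loopSpan {m M : ℕ} (hm : 1 ≤ m) (hM : M ≤ n) :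
    braidSpan n (m + 1) M * loopSpan n m ≤ loopSpan n m * braidSpan n (m + 1) M := by
  refine braidSpan_mul_span_le (by omega) hM ?_
  rintro i h₁ h₂ _ ⟨t, ht, rfl⟩
  have hc : Commute t (g n i) := by
    obtain ⟨b, rfl | rfl⟩ := exists_looping_of_mem_LoopU ht
    · exact commute_looping_g b hm h₁ (h₂.trans_le hM)
    · exact (commute_looping_g b hm h₁ (h₂.trans_le hM)).inv_left
  rw [← Units.val_mul, ← hc.eq, Units.val_mul]
  exact Submodule.mul_mem_mul (mem_loopSpan ht) (g_mem_braidSpan h₁ h₂)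

theorem braidSpan_mul_loopSpanIcc {m M : ℕ} (hm : 1 ≤ m) (hM : M ≤ n) :
    braidSpan n m M * loopSpanIcc n m M ≤ loopSpanIcc n m M * braidSpan n m M := by
  refine braidSpan_mul_span_le hm hM ?_
  rintro i h₁ h₂ _ ⟨j, h₃, h₄, t, ht, rfl⟩
  change _ ∈ loopSpanIcc n m M * braidSpan n m M
  have hi : 1 ≤ i := hm.trans h₁
  have hin : i < n := h₂.trans_le hM
  have hq := isQuadratic_g hi hin
  have mem : ∀ {j} {u : (H n)ˣ} {c : (H n)ˣ}, m ≤ j → j ≤ M → u ∈ LoopU n j →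
      (c : H n) ∈ braidSpan n m M →
      ((u * c : (H n)ˣ) : H n) ∈ loopSpanIcc n m M * braidSpan n m M := by
    intro j u c h₁ h₂ hu hc
    rw [Units.val_mul]
    exact Submodule.mul_mem_mul (mem_loopSpanIcc h₁ h₂ hu) hc
  have hg := g_mem_braidSpan (n := n) h₁ h₂
  have hg' := g_inv_mem_braidSpan (n := n) h₁ h₂
  have h1 : ((1 : (H n)ˣ) : H n) ∈ braidSpan n m M := one_mem_braidSpan m M
  rw [← Units.val_mul]
  by_cases hc : Commute (g n i) t
  · rw [hc.eq]
    exact mem h₃ h₄ ht hg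
  obtain ⟨b, hb⟩ := exists_looping_of_mem_LoopU ht
  have hl := looping_mem_LoopU (n := n) b i
  have hl' := looping_inv_mem_LoopU (n := n) b i
  have hs := looping_mem_LoopU (n := n) b (i + 1)
  have hs' := looping_inv_mem_LoopU (n := n) b (i + 1)
  have e := looping_succ (n := n) b hi
  rcases lt_trichotomy j i with h | rfl | h
  · have := commute_looping_g b (hm.trans h₃) h hin
    rcases hb with rfl | rfl
    exacts [absurd this.symm hc, absurd this.inv_left.symm hc]
  · rcases hb with rfl | rfl
    · convert mem (by omega) h₂ hs hg' using 2
      rw [e]; group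
    · have := hq.swap_units (N := loopSpanIcc n m M * braidSpan n m M) 1 (looping n b j)⁻¹ ?_ ?_
      · simpa using this
      · convert mem (by omega) h₂ hs' hg using 2
        rw [e]; group
      · convert mem h₃ h₄ hl' h1 using 2
        group
  · rcases (show i + 1 ≤ j from h).eq_or_lt with rfl | h
    · rcases hb with rfl | rfl
      · have := hq.swap_units (N := loopSpanIcc n m M * braidSpan n m M) 1
          (looping n b (i + 1)) ?_ ?_
        · simpa using this
        · convert mem h₁ (by omega) hl hg using 2
          rw [e]; group
        · convert mem h₃ h₄ hs h1 using 2
          group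
      · convert mem h₁ (by omega) hl' hg' using 2
        rw [e]; group
    · have := commute_g_looping b hi h (h₄.trans hM)
      rcases hb with rfl | rfl
      exacts [absurd this hc, absurd this.inv_right hc]

theorem braidSpan_mul_loopSpanIcc_pow {m M : ℕ} (hm : 1 ≤ m) (hM : M ≤ n) (k : ℕ) :
    braidSpan n m M * loopSpanIcc n m M ^ k ≤ loopSpanIcc n m M ^ k * braidSpan n m M := by
  induction k with
  | zero => simp
  | succ k ih =>
    calc braidSpan n m M * loopSpanIcc n m M ^ (k + 1)
        = (braidSpan n m M * loopSpanIcc n m M ^ k) * loopSpanIcc n m M := by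
          rw [pow_succ, mul_assoc]
      _ ≤ (loopSpanIcc n m M ^ k * braidSpan n m M) * loopSpanIcc n m M :=
          mul_le_mul_left ih _
      _ = loopSpanIcc n m M ^ k * (braidSpan n m M * loopSpanIcc n m M) := mul_assoc _ _ _
      _ ≤ loopSpanIcc n m M ^ k * (loopSpanIcc n m M * braidSpan n m M) :=
          mul_le_mul_right (braidSpan_mul_loopSpanIcc hm hM) _
      _ = _ := by rw [pow_succ, mul_assoc]

theorem braidSpan_mul_wordSpan {m M : ℕ} (hm : 1 ≤ m) (hM : M ≤ n) (k : ℕ) :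
    braidSpan n m M * wordSpan n m M k ≤ wordSpan n m M k := by
  calc braidSpan n m M * wordSpan n m M k
      = braidSpan n m M * loopSpanIcc n m M ^ k * braidSpan n m M := (mul_assoc _ _ _).symm
    _ ≤ loopSpanIcc n m M ^ k * braidSpan n m M * braidSpan n m M :=
        mul_le_mul_left (braidSpan_mul_loopSpanIcc_pow hm hM k) _
    _ = wordSpan n m M k := by rw [mul_assoc, braidSpan_mul_self, wordSpan]

theorem wordSpan_succ (m M k : ℕ) :
    wordSpan n m M (k + 1) = loopSpanIcc n m M * wordSpan n m M k := by
  rw [wordSpan, wordSpan, pow_succ', mul_assoc]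

/-- The span of the products of two loopings of index `m + 1` that do not sort past `𝒯_m^{±1}`
within the index content. -/
def oppositeSpan (n m : ℕ) : Submodule R (H n) :=
  Submodule.span R {x | x = ((looping n false (m + 1) * (looping n true (m + 1))⁻¹ : (H n)ˣ) : H n) ∨
    x = (((looping n false (m + 1))⁻¹ * looping n true (m + 1) : (H n)ˣ) : H n)}

theorem mul_mul_mem_loopSpan {m M j : ℕ} {t u c : (H n)ˣ} (ht : t ∈ LoopU n m) (h₁ : m ≤ j)
    (h₂ : j ≤ M) (hu : u ∈ LoopU n j) (hc : (c : H n) ∈ braidSpan n m M) :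
    ((t * u * c : (H n)ˣ) : H n) ∈ loopSpan n m * loopSpanIcc n m M * braidSpan n m M := by
  rw [Units.val_mul, Units.val_mul]
  exact Submodule.mul_mem_mul (Submodule.mul_mem_mul (mem_loopSpan ht) (mem_loopSpanIcc h₁ h₂ hu))
    hc

theorem commute_looping_looping (b c : Bool) (hbc : b = false ∨ c = true) {i : ℕ}
    (h : 1 ≤ i) (h₁ : i < n) : Commute (looping n b i) (looping n c (i + 1)) := by
  rw [looping_succ c h]
  exact commute_looping_looping_succ b c hbc h h₁

theorem mul_mem_of_mem_mul {m M : ℕ} (hm : 1 ≤ m) (hM : M ≤ n) {x : H n} {t : (H n)ˣ} {j : ℕ}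
    (hx : x ∈ loopSpan n m * loopSpanIcc n m M * braidSpan n m M) (h₁ : m ≤ j) (h₂ : j ≤ M)
    (ht : t ∈ LoopU n j) : x * t ∈ loopSpan n m * wordSpan n m M 2 := by
  have h := Submodule.mul_mem_mul hx (mem_loopSpanIcc h₁ h₂ ht)
  refine SetLike.le_def.1 ?_ h
  calc loopSpan n m * loopSpanIcc n m M * braidSpan n m M * loopSpanIcc n m M
      = loopSpan n m * loopSpanIcc n m M * (braidSpan n m M * loopSpanIcc n m M) := mul_assoc _ _ _
    _ ≤ loopSpan n m * loopSpanIcc n m M * (loopSpanIcc n m M * braidSpan n m M) :=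
        mul_le_mul_right (braidSpan_mul_loopSpanIcc hm hM) _
    _ = _ := by rw [wordSpan, pow_two]; simp only [mul_assoc]

theorem mul_mul_mul_mem_loopSpan {m M : ℕ} {t u v c : (H n)ˣ} {i j : ℕ} (ht : t ∈ LoopU n m) (hi : m ≤ i)
    (hi' : i ≤ M) (hu : u ∈ LoopU n i) (hj : m ≤ j) (hj' : j ≤ M) (hv : v ∈ LoopU n j)
    (hc : (c : H n) ∈ braidSpan n m M) :
    ((t * u * v * c : (H n)ˣ) : H n) ∈ loopSpan n m * wordSpan n m M 2 := by
  simp only [wordSpan, pow_two, Units.val_mul, mul_assoc]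
  exact Submodule.mul_mem_mul (mem_loopSpan ht) (Submodule.mul_mem_mul (mem_loopSpanIcc hi hi' hu)
    (Submodule.mul_mem_mul (mem_loopSpanIcc hj hj' hv) hc))

section Straightening

variable {m M : ℕ} (hm : 1 ≤ m) (hmM : m < M) (hM : M ≤ n)
include hm hmM hM

theorem looping_succ_mul_looping_mem :
    ((looping n false (m + 1) * looping n true m : (H n)ˣ) : H n) ∈
      loopSpan n m * loopSpanIcc n m M * braidSpan n m M := by
  have hq := isQuadratic_g hm (hmM.trans_le hM)
  have hc := commute_looping_looping_succ false true (Or.inl rfl) hm (hmM.trans_le hM)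
  have hg := g_inv_mem_braidSpan (n := n) (le_refl m) hmM
  have h₁ := mul_mul_mem_loopSpan (looping_mem_LoopU (n := n) true m) (Nat.le_succ m) hmM
    (looping_mem_LoopU false (m + 1)) (c := (g n m)⁻¹ * (g n m)⁻¹)
    (by rw [Units.val_mul]; exact mul_mem_braidSpan hg hg)
  have h₂ := mul_mul_mem_loopSpan (looping_mem_LoopU (n := n) false m) (Nat.le_succ m) hmM
    (looping_mem_LoopU true (m + 1)) (c := (g n m)⁻¹) hg
  rw [looping_succ _ hm] at h₁ h₂ ⊢
  exact swap_same_sign hq hc h₁ h₂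

theorem looping_succ_inv_mul_looping_inv_mem :
    (((looping n false (m + 1))⁻¹ * (looping n true m)⁻¹ : (H n)ˣ) : H n) ∈
      loopSpan n m * loopSpanIcc n m M * braidSpan n m M := by
  have hq := (isQuadratic_g hm (hmM.trans_le hM)).inv
  have hc := (commute_looping_looping_succ false true (Or.inl rfl) hm (hmM.trans_le hM)).inv_inv
  have hg := g_mem_braidSpan (n := n) (le_refl m) hmM
  have h₁ := mul_mul_mem_loopSpan (looping_inv_mem_LoopU (n := n) true m) (Nat.le_succ m) hmM
    (looping_inv_mem_LoopU false (m + 1)) (c := g n m * g n m)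
    (by rw [Units.val_mul]; exact mul_mem_braidSpan hg hg)
  have h₂ := mul_mul_mem_loopSpan (looping_inv_mem_LoopU (n := n) false m) (Nat.le_succ m) hmM
    (looping_inv_mem_LoopU true (m + 1)) (c := g n m) hg
  rw [looping_succ _ hm] at h₁ h₂ ⊢
  simp only [mul_inv_rev, ← mul_assoc] at hc h₁ h₂ ⊢
  refine swap_same_sign hq hc ?_ ?_
  · simpa only [inv_inv, mul_assoc] using h₁
  · simpa only [inv_inv, mul_assoc] using h₂

theorem looping_succ_mul_looping_inv_mem :
    ((looping n false (m + 1) * (looping n true m)⁻¹ : (H n)ˣ) : H n) ∈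
      loopSpan n m * loopSpanIcc n m M * braidSpan n m M ⊔ oppositeSpan n m * braidSpan n m M := by
  have hq := isQuadratic_g hm (hmM.trans_le hM)
  have hc := commute_looping_looping_succ false true (Or.inl rfl) hm (hmM.trans_le hM)
  have hg := g_mem_braidSpan (n := n) (le_refl m) hmM
  have h₁ := mul_mul_mem_loopSpan (looping_inv_mem_LoopU (n := n) true m) (Nat.le_succ m) hmM
    (looping_mem_LoopU false (m + 1)) (c := 1) (one_mem_braidSpan m M)
  have h₂ := mul_mul_mem_loopSpan (looping_inv_mem_LoopU (n := n) true m) le_rfl hmM.le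
    (looping_mem_LoopU false m) hg
  have h₃ := Submodule.mul_mem_mul (M := oppositeSpan n m)
    (Submodule.subset_span (Or.inl rfl)) hg
  rw [← Units.val_mul] at h₃
  rw [looping_succ _ hm] at h₁ h₃ ⊢
  rw [looping_succ _ hm] at h₃
  rw [mul_one] at h₁
  exact swap_opposite_sign hq hc (Submodule.mem_sup_left h₁) (Submodule.mem_sup_left h₂)
    (Submodule.mem_sup_right h₃)

theorem looping_succ_inv_mul_looping_mem :
    (((looping n false (m + 1))⁻¹ * looping n true m : (H n)ˣ) : H n) ∈
      loopSpan n m * loopSpanIcc n m M * braidSpan n m M ⊔ oppositeSpan n m * braidSpan n m M := by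
  have hq := (isQuadratic_g hm (hmM.trans_le hM)).inv
  have hc := (commute_looping_looping_succ false true (Or.inl rfl) hm (hmM.trans_le hM)).inv_inv
  have hg := g_inv_mem_braidSpan (n := n) (le_refl m) hmM
  have h₁ := mul_mul_mem_loopSpan (looping_mem_LoopU (n := n) true m) (Nat.le_succ m) hmM
    (looping_inv_mem_LoopU false (m + 1)) (c := 1) (one_mem_braidSpan m M)
  have h₂ := mul_mul_mem_loopSpan (looping_mem_LoopU (n := n) true m) le_rfl hmM.le
    (looping_inv_mem_LoopU false m) hg
  have h₃ := Submodule.mul_mem_mul (M := oppositeSpan n m)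
    (Submodule.subset_span (Or.inr rfl)) hg
  rw [← Units.val_mul] at h₃
  rw [looping_succ _ hm] at h₁ h₃ ⊢
  rw [looping_succ _ hm] at h₃
  rw [mul_one] at h₁
  have := swap_opposite_sign hq (x := (looping n false m)⁻¹) (y := (looping n true m)⁻¹)
    (N := loopSpan n m * loopSpanIcc n m M * braidSpan n m M ⊔
      oppositeSpan n m * braidSpan n m M)
    (by simpa only [mul_inv_rev, mul_assoc] using hc)
    (Submodule.mem_sup_left (by simpa only [mul_inv_rev, mul_assoc, inv_inv] using h₁))
    (Submodule.mem_sup_left (by simpa only [mul_inv_rev, mul_assoc, inv_inv] using h₂))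
    (Submodule.mem_sup_right (by simpa only [mul_inv_rev, mul_assoc, inv_inv] using h₃))
  simpa only [mul_inv_rev, mul_assoc, inv_inv] using this

theorem loopSpan_succ_mul_loopSpan :
    loopSpan n (m + 1) * loopSpan n m ≤
      loopSpan n m * loopSpanIcc n m M * braidSpan n m M ⊔ oppositeSpan n m * braidSpan n m M := by
  rw [loopSpan, loopSpan, Submodule.span_mul_span, Submodule.span_le]
  rintro _ ⟨_, ⟨t, ht, rfl⟩, _, ⟨u, hu, rfl⟩, rfl⟩
  change (t : H n) * (u : H n) ∈ loopSpan n m * loopSpanIcc n m M * braidSpan n m M ⊔ _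
  rw [← Units.val_mul]
  have comm : Commute u t → ((t * u : (H n)ˣ) : H n) ∈
      loopSpan n m * loopSpanIcc n m M * braidSpan n m M ⊔
        oppositeSpan n m * braidSpan n m M := by
    intro hc
    rw [← hc.eq, ← mul_one (u * t)]
    exact Submodule.mem_sup_left
      (mul_mul_mem_loopSpan hu (Nat.le_succ m) hmM ht (one_mem_braidSpan m M))
  obtain ⟨b, hb⟩ := exists_looping_of_mem_LoopU ht
  obtain ⟨c, hc⟩ := exists_looping_of_mem_LoopU hu
  by_cases hbc : c = false ∨ b = true
  · have := commute_looping_looping c b hbc hm (hmM.trans_le hM)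
    apply comm
    rcases hb with rfl | rfl <;> rcases hc with rfl | rfl
    exacts [this, this.inv_left, this.inv_right, this.inv_inv]
  · obtain ⟨rfl, rfl⟩ : c = true ∧ b = false := by simpa using hbc
    rcases hb with rfl | rfl <;> rcases hc with rfl | rfl
    exacts [Submodule.mem_sup_left (looping_succ_mul_looping_mem hm hmM hM),
      looping_succ_mul_looping_inv_mem hm hmM hM, looping_succ_inv_mul_looping_mem hm hmM hM,
      Submodule.mem_sup_left (looping_succ_inv_mul_looping_inv_mem hm hmM hM)]

theorem opposite_mul_looping_inv_mem :
    ((looping n false (m + 1) * (looping n true (m + 1))⁻¹ * (looping n true m)⁻¹ : (H n)ˣ) : H n) ∈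
      loopSpan n m * wordSpan n m M 2 := by
  have hq := isQuadratic_g hm (hmM.trans_le hM)
  have hc := commute_looping_looping_succ false true (Or.inl rfl) hm (hmM.trans_le hM)
  have hc' := commute_looping_looping_succ true true (Or.inr rfl) hm (hmM.trans_le hM)
  have hg := g_mem_braidSpan (n := n) (le_refl m) hmM
  have h₁ := mul_mul_mul_mem_loopSpan (looping_inv_mem_LoopU (n := n) true m)
    (Nat.le_succ m) hmM (looping_mem_LoopU false (m + 1)) (Nat.le_succ m) hmM
    (looping_inv_mem_LoopU true (m + 1)) (c := g n m * g n m)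
    (by rw [Units.val_mul]; exact mul_mem_braidSpan hg hg)
  have h₂ := mul_mul_mul_mem_loopSpan (looping_inv_mem_LoopU (n := n) true m)
    le_rfl hmM.le (looping_mem_LoopU false m) le_rfl hmM.le (looping_inv_mem_LoopU true m) hg
  rw [looping_succ _ hm, looping_succ _ hm] at h₁ ⊢
  exact swap_triple hq hc hc' h₁ h₂

theorem opposite_inv_mul_looping_mem :
    (((looping n false (m + 1))⁻¹ * looping n true (m + 1) * looping n true m : (H n)ˣ) : H n) ∈
      loopSpan n m * wordSpan n m M 2 := by
  have hq := (isQuadratic_g hm (hmM.trans_le hM)).inv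
  have hc := (commute_looping_looping_succ false true (Or.inl rfl) hm (hmM.trans_le hM)).inv_inv
  have hc' := (commute_looping_looping_succ true true (Or.inr rfl) hm (hmM.trans_le hM)).inv_inv
  have hg := g_inv_mem_braidSpan (n := n) (le_refl m) hmM
  have h₁ := mul_mul_mul_mem_loopSpan (looping_mem_LoopU (n := n) true m)
    (Nat.le_succ m) hmM (looping_inv_mem_LoopU false (m + 1)) (Nat.le_succ m) hmM
    (looping_mem_LoopU true (m + 1)) (c := (g n m)⁻¹ * (g n m)⁻¹)
    (by rw [Units.val_mul]; exact mul_mem_braidSpan hg hg)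
  have h₂ := mul_mul_mul_mem_loopSpan (looping_mem_LoopU (n := n) true m)
    le_rfl hmM.le (looping_inv_mem_LoopU false m) le_rfl hmM.le (looping_mem_LoopU true m) hg
  rw [looping_succ _ hm, looping_succ _ hm] at h₁ ⊢
  have := swap_triple hq (x := (looping n false m)⁻¹) (y := (looping n true m)⁻¹)
    (N := loopSpan n m * wordSpan n m M 2)
    (by simpa only [mul_inv_rev, mul_assoc] using hc)
    (by simpa only [mul_inv_rev, mul_assoc] using hc')
    (by simpa only [mul_inv_rev, mul_assoc, inv_inv] using h₁)
    (by simpa only [mul_inv_rev, mul_assoc, inv_inv] using h₂)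
  simpa only [mul_inv_rev, mul_assoc, inv_inv] using this

theorem oppositeSpan_mul_loopSpan :
    oppositeSpan n m * loopSpan n m ≤ loopSpan n m * wordSpan n m M 2 := by
  rw [oppositeSpan, loopSpan, Submodule.span_mul_span, Submodule.span_le]
  rintro _ ⟨x, hx, _, ⟨u, hu, rfl⟩, rfl⟩
  change x * (u : H n) ∈ loopSpan n m * wordSpan n m M 2
  have hmn := hmM.trans_le hM
  have key : ∀ {t v : (H n)ˣ}, t ∈ LoopU n (m + 1) → v ∈ LoopU n (m + 1) → Commute t u →
      Commute v u → ((t * v * u : (H n)ˣ) : H n) ∈ loopSpan n m * wordSpan n m M 2 := by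
    intro t v ht hv h₁ h₂
    rw [(h₁.mul_left h₂).eq, ← mul_one (u * (t * v)), ← mul_assoc]
    exact mul_mul_mul_mem_loopSpan hu (Nat.le_succ m) hmM ht (Nat.le_succ m) hmM hv
      (one_mem_braidSpan m M)
  have h₁ := looping_mem_LoopU (n := n) false (m + 1)
  have h₁' := looping_inv_mem_LoopU (n := n) false (m + 1)
  have h₂ := looping_mem_LoopU (n := n) true (m + 1)
  have h₂' := looping_inv_mem_LoopU (n := n) true (m + 1)
  have hc₁ := (commute_looping_looping false false (Or.inl rfl) hm hmn).symm
  have hc₂ := (commute_looping_looping false true (Or.inl rfl) hm hmn).symm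
  have hc₃ := (commute_looping_looping true true (Or.inr rfl) hm hmn).symm
  obtain ⟨b, hb⟩ := exists_looping_of_mem_LoopU hu
  rcases hx with rfl | rfl <;> rw [← Units.val_mul] <;> cases b <;> rcases hb with rfl | rfl
  · exact key h₁ h₂' hc₁ hc₂.inv_left
  · exact key h₁ h₂' hc₁.inv_right hc₂.inv_inv
  · rw [mul_assoc, hc₃.inv_left.eq, ← mul_assoc, Units.val_mul]
    exact mul_mem_of_mem_mul hm hM (looping_succ_mul_looping_mem hm hmM hM) (Nat.le_succ m)
      hmM h₂'
  · exact opposite_mul_looping_inv_mem hm hmM hM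
  · exact key h₁' h₂ hc₁.inv_left hc₂
  · exact key h₁' h₂ hc₁.inv_inv hc₂.inv_right
  · exact opposite_inv_mul_looping_mem hm hmM hM
  · rw [mul_assoc, hc₃.inv_right.eq, ← mul_assoc, Units.val_mul]
    exact mul_mem_of_mem_mul hm hM (looping_succ_inv_mul_looping_inv_mem hm hmM hM)
      (Nat.le_succ m) hmM h₂

end Straightening

variable {m M : ℕ}

theorem loopSpanIcc_le_braidSpan_mul (hm : 1 ≤ m) :
    loopSpanIcc n m M ≤ braidSpan n m M * loopSpan n m * braidSpan n m M := by
  have key : ∀ i, m ≤ i → i ≤ M →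
      loopSpan n i ≤ braidSpan n m M * loopSpan n m * braidSpan n m M := by
    intro i h
    induction i, h using Nat.le_induction with
    | base => exact fun _ => (le_braidSpan_mul _).trans (le_mul_braidSpan _)
    | succ i h ih =>
      intro hi
      rw [loopSpan, Submodule.span_le]
      rintro _ ⟨t, ht, rfl⟩
      have hg := g_mem_braidSpan (n := n) h hi
      have hg' := g_inv_mem_braidSpan (n := n) h hi
      have : ∃ c u : (H n)ˣ, (c : H n) ∈ braidSpan n m M ∧ u ∈ LoopU n i ∧ t = c * u * c := by
        obtain ⟨b, rfl | rfl⟩ := exists_looping_of_mem_LoopU ht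
        · exact ⟨_, _, hg, looping_mem_LoopU b i, looping_succ b (hm.trans h)⟩
        · refine ⟨_, _, hg', looping_inv_mem_LoopU b i, ?_⟩
          rw [looping_succ b (hm.trans h)]
          group
      obtain ⟨c, u, hc, hu, rfl⟩ := this
      change ((c * u * c : (H n)ˣ) : H n) ∈ braidSpan n m M * loopSpan n m * braidSpan n m M
      rw [← braidSpan_mul_self, Units.val_mul, Units.val_mul, ← mul_assoc (_ * _),
        mul_assoc (braidSpan n m M), mul_assoc (braidSpan n m M)]
      exact Submodule.mul_mem_mul (Submodule.mul_mem_mul hc (ih (by omega) (mem_loopSpan hu))) hc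
  refine Submodule.span_le.2 ?_
  rintro _ ⟨i, h₁, h₂, t, ht, rfl⟩
  exact key i h₁ h₂ (mem_loopSpan ht)

theorem braidSpan_succ_mul_wordSpan (hm : 1 ≤ m) (hM : M ≤ n) (k : ℕ) :
    braidSpan n (m + 1) M * wordSpan n m M k ≤ wordSpan n m M k :=
  (mul_le_mul_left (braidSpan_mono (Nat.le_succ m)) _).trans (braidSpan_mul_wordSpan hm hM k)

theorem oppositeSpan_le (hmM : m < M) : oppositeSpan n m ≤ loopSpanIcc n (m + 1) M ^ 2 := by
  rw [oppositeSpan, Submodule.span_le, pow_two]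
  rintro _ (rfl | rfl) <;> rw [Units.val_mul]
  · exact Submodule.mul_mem_mul (mem_loopSpanIcc le_rfl hmM (looping_mem_LoopU false _))
      (mem_loopSpanIcc le_rfl hmM (looping_inv_mem_LoopU true _))
  · exact Submodule.mul_mem_mul (mem_loopSpanIcc le_rfl hmM (looping_inv_mem_LoopU false _))
      (mem_loopSpanIcc le_rfl hmM (looping_mem_LoopU true _))

/-- Words of length `k + 1` starting with a looping of minimal index, together with the words
avoiding the minimal index. -/
def leadingSpan (n m M k : ℕ) : Submodule R (H n) :=
  loopSpan n m * wordSpan n m M k ⊔ loopSpanIcc n (m + 1) M ^ (k + 1) * braidSpan n m M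

theorem braidSpan_succ_mul_leadingSpan (hm : 1 ≤ m) (hM : M ≤ n) (k : ℕ) :
    braidSpan n (m + 1) M * leadingSpan n m M k ≤ leadingSpan n m M k := by
  rw [leadingSpan, Submodule.mul_sup]
  refine sup_le_sup ?_ ?_
  · calc braidSpan n (m + 1) M * (loopSpan n m * wordSpan n m M k)
        = (braidSpan n (m + 1) M * loopSpan n m) * wordSpan n m M k := (mul_assoc _ _ _).symm
      _ ≤ (loopSpan n m * braidSpan n (m + 1) M) * wordSpan n m M k :=
          mul_le_mul_left (braidSpan_succ_mul_loopSpan hm hM) _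
      _ = loopSpan n m * (braidSpan n (m + 1) M * wordSpan n m M k) := mul_assoc _ _ _
      _ ≤ loopSpan n m * wordSpan n m M k :=
          mul_le_mul_right (braidSpan_succ_mul_wordSpan hm hM k) _
  · calc braidSpan n (m + 1) M * (loopSpanIcc n (m + 1) M ^ (k + 1) * braidSpan n m M)
        = (braidSpan n (m + 1) M * loopSpanIcc n (m + 1) M ^ (k + 1)) * braidSpan n m M :=
          (mul_assoc _ _ _).symm
      _ ≤ (loopSpanIcc n (m + 1) M ^ (k + 1) * braidSpan n (m + 1) M) * braidSpan n m M :=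
          mul_le_mul_left (braidSpan_mul_loopSpanIcc_pow (by omega) hM _) _
      _ ≤ (loopSpanIcc n (m + 1) M ^ (k + 1) * braidSpan n m M) * braidSpan n m M :=
          mul_le_mul_left (mul_le_mul_right (braidSpan_mono (Nat.le_succ m)) _) _
      _ = _ := by rw [mul_assoc, braidSpan_mul_self]

theorem oppositeSpan_mul_wordSpan (hm : 1 ≤ m) (hmM : m < M) (hM : M ≤ n) {k : ℕ}
    (ih : ∀ j, j < k → wordSpan n m M (j + 1) ≤ leadingSpan n m M j) :
    oppositeSpan n m * wordSpan n m M k ≤ leadingSpan n m M (k + 1) := by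
  have habove : ∀ j, oppositeSpan n m * (loopSpanIcc n (m + 1) M ^ j * braidSpan n m M) ≤
      leadingSpan n m M (j + 1) := by
    intro j
    refine le_trans ?_ le_sup_right
    rw [← mul_assoc, show j + 1 + 1 = 2 + j by ring, pow_add]
    exact mul_le_mul_left (mul_le_mul_left (oppositeSpan_le hmM) _) _
  rcases k with _ | k
  · simpa [wordSpan] using habove 0
  · refine (mul_le_mul_right (ih k k.lt_succ_self) _).trans ?_
    rw [leadingSpan, Submodule.mul_sup]
    refine sup_le (le_trans ?_ le_sup_left) (habove _)
    calc oppositeSpan n m * (loopSpan n m * wordSpan n m M k)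
        = (oppositeSpan n m * loopSpan n m) * wordSpan n m M k := (mul_assoc _ _ _).symm
      _ ≤ (loopSpan n m * wordSpan n m M 2) * wordSpan n m M k :=
          mul_le_mul_left (oppositeSpan_mul_loopSpan hm hmM hM) _
      _ = loopSpan n m * (loopSpanIcc n m M ^ 2 * (braidSpan n m M * wordSpan n m M k)) := by
          rw [wordSpan]; simp only [mul_assoc]
      _ ≤ loopSpan n m * (loopSpanIcc n m M ^ 2 * wordSpan n m M k) :=
          mul_le_mul_right (mul_le_mul_right (braidSpan_mul_wordSpan hm hM k) _) _
      _ = loopSpan n m * wordSpan n m M (k + 1 + 1) := by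
          rw [wordSpan, wordSpan, ← mul_assoc (_ ^ 2), ← pow_add, show 2 + k = k + 1 + 1 by ring]

theorem wordSpan_succ_le_leadingSpan (hm : 1 ≤ m) (hmM : m < M) (hM : M ≤ n) (k : ℕ) :
    wordSpan n m M (k + 1) ≤ leadingSpan n m M k := by
  induction k using Nat.strong_induction_on with
  | _ k ih =>
  rw [wordSpan_succ]
  refine (mul_le_mul_left loopSpanIcc_le_sup _).trans ?_
  rw [Submodule.sup_mul]
  refine sup_le le_sup_left ?_
  rcases k with _ | k
  · refine le_trans ?_ le_sup_right
    simp [wordSpan]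
  refine (mul_le_mul_right (ih k k.lt_succ_self) _).trans ?_
  rw [leadingSpan, Submodule.mul_sup]
  refine sup_le ?_ (le_trans ?_ le_sup_right)
  · have hopp := oppositeSpan_mul_wordSpan hm hmM hM (fun j hj => ih j (hj.trans k.lt_succ_self))
    have hbw := braidSpan_mul_wordSpan (n := n) hm hM k
    calc loopSpanIcc n (m + 1) M * (loopSpan n m * wordSpan n m M k)
        ≤ (braidSpan n (m + 1) M * loopSpan n (m + 1) * braidSpan n (m + 1) M) *
            (loopSpan n m * wordSpan n m M k) :=
          mul_le_mul_left (loopSpanIcc_le_braidSpan_mul (by omega)) _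
      _ = braidSpan n (m + 1) M * loopSpan n (m + 1) *
            ((braidSpan n (m + 1) M * loopSpan n m) * wordSpan n m M k) := by
          simp only [mul_assoc]
      _ ≤ braidSpan n (m + 1) M * loopSpan n (m + 1) *
            ((loopSpan n m * braidSpan n (m + 1) M) * wordSpan n m M k) :=
          mul_le_mul_right (mul_le_mul_left (braidSpan_succ_mul_loopSpan hm hM) _) _
      _ = braidSpan n (m + 1) M * loopSpan n (m + 1) * loopSpan n m *
            (braidSpan n (m + 1) M * wordSpan n m M k) := by simp only [mul_assoc]
      _ ≤ braidSpan n (m + 1) M * loopSpan n (m + 1) * loopSpan n m * wordSpan n m M k :=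
          mul_le_mul_right (braidSpan_succ_mul_wordSpan hm hM k) _
      _ = braidSpan n (m + 1) M * ((loopSpan n (m + 1) * loopSpan n m) * wordSpan n m M k) := by
          simp only [mul_assoc]
      _ ≤ braidSpan n (m + 1) M * ((loopSpan n m * loopSpanIcc n m M * braidSpan n m M ⊔
            oppositeSpan n m * braidSpan n m M) * wordSpan n m M k) :=
          mul_le_mul_right (mul_le_mul_left (loopSpan_succ_mul_loopSpan hm hmM hM) _) _
      _ = braidSpan n (m + 1) M *
            (loopSpan n m * loopSpanIcc n m M * (braidSpan n m M * wordSpan n m M k) ⊔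
              oppositeSpan n m * (braidSpan n m M * wordSpan n m M k)) := by
          rw [Submodule.sup_mul, mul_assoc (_ * _), mul_assoc (oppositeSpan n m)]
      _ ≤ braidSpan n (m + 1) M * leadingSpan n m M (k + 1) := by
          refine mul_le_mul_right (sup_le ?_ ?_) _
          · refine (mul_le_mul_right hbw _).trans (le_trans (le_of_eq ?_) le_sup_left)
            rw [wordSpan_succ, mul_assoc]
          · exact (mul_le_mul_right hbw _).trans hopp
      _ ≤ leadingSpan n m M (k + 1) := braidSpan_succ_mul_leadingSpan hm hM _
  · rw [← mul_assoc, ← pow_succ']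

/-- The span of the products of `k` loopings with non-decreasing indices in `[m, M]`, times
braiding generators. -/
def sortedSpan (n m M k : ℕ) : Submodule R (H n) :=
  Submodule.span R
    {x : H n | ∃ (idx' : Fin k → ℕ) (t' : Fin k → (H n)ˣ) (G : H n),
      (∀ j, m ≤ idx' j ∧ idx' j ≤ M) ∧ Monotone idx' ∧
      (∀ j, t' j ∈ LoopU n (idx' j)) ∧
      G ∈ Submonoid.closure (BraidPM n m M) ∧
      x = (((List.ofFn t').prod : (H n)ˣ) : H n) * G}

theorem loopSpan_mul_sortedSpan (hmM : m ≤ M) (k : ℕ) :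
    loopSpan n m * sortedSpan n m M k ≤ sortedSpan n m M (k + 1) := by
  rw [loopSpan, sortedSpan, Submodule.span_mul_span]
  refine Submodule.span_mono ?_
  rintro _ ⟨_, ⟨t, ht, rfl⟩, _, ⟨idx', t', G, h₁, h₂, h₃, hG, rfl⟩, rfl⟩
  refine ⟨Fin.cons m idx', Fin.cons t t', G, ?_, ?_, ?_, hG, ?_⟩
  · exact Fin.cases ⟨le_rfl, hmM⟩ (by simpa using h₁)
  · intro i
    refine Fin.cases ?_ (fun i => ?_) i <;> refine fun j => Fin.cases ?_ (fun j => ?_) j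
    · simp
    · simpa using (h₁ j).1
    · simp
    · simpa using @h₂ i j
  · exact Fin.cases (by simpa using ht) (by simpa using h₃)
  · simp [List.ofFn_succ, mul_assoc]

theorem sortedSpan_succ_mul_braidSpan (k : ℕ) :
    sortedSpan n (m + 1) M k * braidSpan n m M ≤ sortedSpan n m M k := by
  rw [sortedSpan, braidSpan, Submodule.span_mul_span]
  refine Submodule.span_mono ?_
  rintro _ ⟨_, ⟨idx', t', G, h₁, h₂, h₃, hG, rfl⟩, c, hc, rfl⟩
  refine ⟨idx', t', G * c, fun j => ⟨by have := (h₁ j).1; omega, (h₁ j).2⟩, h₂, h₃, ?_,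
    mul_assoc _ _ _⟩
  refine mul_mem (Submonoid.closure_mono ?_ hG) hc
  rintro _ ⟨i, h, h', hx⟩
  exact ⟨i, by omega, h', hx⟩

theorem braidSpan_le_sortedSpan_zero : braidSpan n m M ≤ sortedSpan n m M 0 := by
  refine Submodule.span_mono fun G hG => ?_
  exact ⟨Fin.elim0, Fin.elim0, G, fun j => j.elim0, fun j => j.elim0, fun j => j.elim0, hG,
    by simp⟩

theorem wordSpan_le_sortedSpan (hm : 1 ≤ m) (hmM : m ≤ M) (hM : M ≤ n) (k : ℕ) :
    wordSpan n m M k ≤ sortedSpan n m M k := by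
  induction hmM using Nat.decreasingInduction generalizing k with
  | self =>
    induction k with
    | zero => simpa [wordSpan] using braidSpan_le_sortedSpan_zero
    | succ k ih =>
      rw [wordSpan_succ]
      refine le_trans (mul_le_mul' ?_ ih) (loopSpan_mul_sortedSpan le_rfl k)
      refine Submodule.span_le.2 ?_
      rintro _ ⟨i, h₁, h₂, t, ht, rfl⟩
      obtain rfl := le_antisymm h₁ h₂
      exact mem_loopSpan ht
  | of_succ m hmM ihm =>
    induction k with
    | zero => simpa [wordSpan] using braidSpan_le_sortedSpan_zero
    | succ k ih =>
      refine (wordSpan_succ_le_leadingSpan hm hmM hM k).trans (sup_le ?_ ?_)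
      · exact (mul_le_mul_right ih _).trans (loopSpan_mul_sortedSpan hmM.le k)
      · refine (mul_le_mul_left ?_ _).trans (sortedSpan_succ_mul_braidSpan (k + 1))
        exact (le_mul_braidSpan _).trans (ihm (by omega) (k + 1))

theorem prod_ofFn_mem_loopSpanIcc_pow {k : ℕ} {idx : Fin k → ℕ} {t : Fin k → (H n)ˣ}
    (ht : ∀ j, t j ∈ LoopU n (idx j)) (hm : ∀ j, m ≤ idx j) (hM : ∀ j, idx j ≤ M) :
    (((List.ofFn t).prod : (H n)ˣ) : H n) ∈ loopSpanIcc n m M ^ k := by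
  induction k with
  | zero => exact ⟨1, by simp⟩
  | succ k ih =>
    rw [List.ofFn_succ, List.prod_cons, Units.val_mul, pow_succ']
    exact Submodule.mul_mem_mul (mem_loopSpanIcc (hm 0) (hM 0) (ht 0))
      (ih (fun j => ht j.succ) (fun j => hm j.succ) (fun j => hM j.succ))

end Submodules

/-- **Theorem 2, Part A.** Any product `w = t₁ t₂ ⋯ t_k` of `k ≥ 1` loopings, with indices
`idx j ∈ [1,n]`, minimum index `m` and maximum index `M`, is a finite `ℤ[q,q⁻¹]`-linear
combination of elements `w' G`, where `w'` is a product of `k` loopings whose indices lie in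
`[m,M]` and increase (weakly) from left to right, and `G` is a finite product of elements
`g_i^{±1}` with `i ∈ [m, M-1]` (so `G = 1` when `m = M`). -/
theorem partA (n : ℕ) (hn : 1 ≤ n) (k : ℕ) (hk : 1 ≤ k)
    (idx : Fin k → ℕ) (hidx : ∀ j, 1 ≤ idx j ∧ idx j ≤ n)
    (t : Fin k → (H n)ˣ) (ht : ∀ j, t j ∈ LoopU n (idx j))
    (m M : ℕ) (hm : ∀ j, m ≤ idx j) (hm' : ∃ j, idx j = m)
    (hM : ∀ j, idx j ≤ M) (hM' : ∃ j, idx j = M) :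
    (((List.ofFn t).prod : (H n)ˣ) : H n) ∈
      Submodule.span R
        {x : H n | ∃ (idx' : Fin k → ℕ) (t' : Fin k → (H n)ˣ) (G : H n),
          (∀ j, m ≤ idx' j ∧ idx' j ≤ M) ∧ Monotone idx' ∧
          (∀ j, t' j ∈ LoopU n (idx' j)) ∧
          G ∈ Submonoid.closure (BraidPM n m M) ∧
          x = (((List.ofFn t').prod : (H n)ˣ) : H n) * G} := by
  obtain ⟨j₀, hj₀⟩ := hm'
  have hmM : m ≤ M := hj₀ ▸ hM j₀
  have hMn : M ≤ n := by
    obtain ⟨j₁, rfl⟩ := hM'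
    exact (hidx j₁).2
  exact wordSpan_le_sortedSpan (hj₀ ▸ (hidx j₀).1) hmM hMn k
    (le_mul_braidSpan _ (prod_ofFn_mem_loopSpanIcc_pow ht hm hM))


end MixedHecke
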